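/- Let H be a finite-dimensional Hopf algebra with antipode S and normalized integrals λ ∈ H*, Λ ∈ H with λ(Λ) = 1. For every positive integer n, every x ∈ H and every linear operator Y : H → H, one has λ(S(x·Y(Λ₍₁₎)·P⁽ⁿ⁾(Λ₍₂₎))) = λ(S(Y(S²(x₍₁₎)·Λ₍₁₎·S(x₍₃₎)) · S²(x₍₂₎) · P⁽ⁿ⁾(Λ₍₂₎))), where P⁽ⁿ⁾(y) = y₍₁₎y₍₂₎⋯y₍ₙ₎ is the n-th Sweedler power. -/

import Mathlib

/-!
STATEMENT 3 (Corollary `c:t2`(i)):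
For a finite-dimensional Hopf algebra H with antipode S and normalized integrals λ, Λ,
for every n ≥ 1, every x ∈ H and every linear Y : H → H:
  λ(S(x · Y(Λ₍₁₎) · P⁽ⁿ⁾(Λ₍₂₎)))
    = λ(S(Y(S²(x₍₁₎)·Λ₍₁₎·S(x₍₃₎)) · S²(x₍₂₎) · P⁽ⁿ⁾(Λ₍₂₎))),
where P⁽ⁿ⁾(y) = y₍₁₎⋯y₍ₙ₎ is the n-th Sweedler power.  Sweedler components are
encoded by arbitrary finite-sum representations of Δ(Λ) and (id ⊗ Δ)(Δ(x)).
-/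

open TensorProduct

/-- The n-th Sweedler power map: the n-th convolution power of the identity,
`P⁽⁰⁾ = unit ∘ counit`, `P⁽ⁿ⁺¹⁾ = m ∘ (id ⊗ P⁽ⁿ⁾) ∘ Δ`, so `P⁽ⁿ⁾(x) = x₍₁₎⋯x₍ₙ₎`. -/
noncomputable def sweedlerPow (k H : Type) [Field k] [Ring H] [HopfAlgebra k H] :
    ℕ → (H →ₗ[k] H)
  | 0 => (Algebra.linearMap k H) ∘ₗ Coalgebra.counit
  | n + 1 => LinearMap.mul' k H ∘ₗ
      (TensorProduct.map LinearMap.id (sweedlerPow k H n)) ∘ₗ Coalgebra.comul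


section Aux

open Coalgebra HopfAlgebra

set_option linter.unusedSectionVars false

variable {k H : Type} [Field k] [Ring H] [HopfAlgebra k H] [FiniteDimensional k H]
variable {M : Type} [AddCommGroup M] [Module k M]

/-- Sweedler sum: `sw k x f = f x₍₁₎ x₍₂₎`, computed in a fixed basis so that it is
linear in both `x` and `f`. -/
noncomputable def sw (k : Type) {H : Type} [Field k] [Ring H] [HopfAlgebra k H]
    [FiniteDimensional k H] {M : Type} [AddCommGroup M] [Module k M]
    (x : H) (f : H → H → M) : M :=
  ∑ p, (((Module.finBasis k H).tensorProduct (Module.finBasis k H)).repr (comul (R := k) x) p) •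
    f (Module.finBasis k H p.1) (Module.finBasis k H p.2)

@[simp] lemma sw_add (x y : H) (f : H → H → M) : sw k (x + y) f = sw k x f + sw k y f := by
  simp [sw, add_smul, Finset.sum_add_distrib]

@[simp] lemma sw_smul (r : k) (x : H) (f : H → H → M) : sw k (r • x) f = r • sw k x f := by
  simp [sw, mul_smul, Finset.smul_sum]

@[simp] lemma sw_add_fun (x : H) (f g : H → H → M) :
    sw k x (fun a b => f a b + g a b) = sw k x f + sw k x g := by
  simp [sw, smul_add, Finset.sum_add_distrib]

@[simp] lemma sw_smul_fun (x : H) (r : k) (f : H → H → M) :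
    sw k x (fun a b => r • f a b) = r • sw k x f := by
  simp only [sw, Finset.smul_sum]
  exact Finset.sum_congr rfl fun _ _ => smul_comm _ _ _

lemma sw_comm (x y : H) (f : H → H → H → H → M) :
    sw k x (fun a b => sw k y (fun c d => f a b c d)) =
      sw k y (fun c d => sw k x (fun a b => f a b c d)) := by
  simp only [sw, Finset.smul_sum]
  rw [Finset.sum_comm]
  exact Finset.sum_congr rfl fun _ _ => Finset.sum_congr rfl fun _ _ => smul_comm _ _ _

lemma map_sw {N : Type} [AddCommGroup N] [Module k N] (φ : M →ₗ[k] N) (x : H) (f : H → H → M) :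
    φ (sw k x f) = sw k x (fun a b => φ (f a b)) := by
  simp [sw]

lemma mul_sw (y x : H) (f : H → H → H) :
    y * (sw k x f) = sw k x (fun a b => y * (f a b)) := by
  simp [sw, Finset.mul_sum]

lemma sw_mul' (y x : H) (f : H → H → H) :
    (sw k x f) * y = sw k x (fun a b => (f a b) * y) := by
  simp [sw, Finset.sum_mul]

/-- Bilinearity predicate. -/
structure Bil (k : Type) {H M : Type} [Field k] [AddCommGroup H] [Module k H]
    [AddCommGroup M] [Module k M] (f : H → H → M) : Prop where
  al : ∀ a a' b, f (a + a') b = f a b + f a' b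
  sl : ∀ (r : k) a b, f (r • a) b = r • f a b
  ar : ∀ a b b', f a (b + b') = f a b + f a b'
  sr : ∀ (r : k) a b, f a (r • b) = r • f a b

/-- Trilinearity predicate. -/
structure Tri (k : Type) {H M : Type} [Field k] [AddCommGroup H] [Module k H]
    [AddCommGroup M] [Module k M] (f : H → H → H → M) : Prop where
  a1 : ∀ a a' b c, f (a + a') b c = f a b c + f a' b c
  s1 : ∀ (r : k) a b c, f (r • a) b c = r • f a b c
  a2 : ∀ a b b' c, f a (b + b') c = f a b c + f a b' c
  s2 : ∀ (r : k) a b c, f a (r • b) c = r • f a b c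
  a3 : ∀ a b c c', f a b (c + c') = f a b c + f a b c'
  s3 : ∀ (r : k) a b c, f a b (r • c) = r • f a b c

lemma Bil.ex {f : H → H → M} (hf : Bil k f) : ∃ F : H →ₗ[k] H →ₗ[k] M, ∀ a b, f a b = F a b :=
  ⟨LinearMap.mk₂ k f hf.al hf.sl hf.ar hf.sr, fun _ _ => rfl⟩

lemma Tri.ex {f : H → H → H → M} (hf : Tri k f) :
    ∃ F : H →ₗ[k] H →ₗ[k] H →ₗ[k] M, ∀ a b c, f a b c = F a b c :=
  ⟨LinearMap.mk₂ k (fun a b => ⟨⟨f a b, hf.a3 a b⟩, fun r c => hf.s3 r a b c⟩)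
    (fun a a' b => LinearMap.ext fun c => hf.a1 a a' b c)
    (fun r a b => LinearMap.ext fun c => hf.s1 r a b c)
    (fun a b b' => LinearMap.ext fun c => hf.a2 a b b' c)
    (fun r a b => LinearMap.ext fun c => hf.s2 r a b c), fun _ _ _ => rfl⟩

lemma sw_lift (F : H →ₗ[k] H →ₗ[k] M) (x : H) :
    sw k x (fun a b => F a b) = TensorProduct.lift F (comul (R := k) x) := by
  conv_rhs => rw [← ((Module.finBasis k H).tensorProduct (Module.finBasis k H)).sum_repr
    (comul (R := k) x)]
  rw [map_sum]
  exact Finset.sum_congr rfl fun p _ => by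
    rw [map_smul, Module.Basis.tensorProduct_apply', TensorProduct.lift.tmul]

lemma sw_eq_sum {ι : Type} (s : Finset ι) (u v : ι → H) (x : H)
    (h : comul (R := k) x = ∑ i ∈ s, u i ⊗ₜ[k] v i) {f : H → H → M} (hf : Bil k f) :
    sw k x f = ∑ i ∈ s, f (u i) (v i) := by
  obtain ⟨F, hF⟩ := hf.ex
  obtain rfl : f = fun a b => F a b := by ext; exact hF _ _
  rw [sw_lift, h]; simp

lemma sw_tmul (x : H) : sw k x (fun a b => a ⊗ₜ[k] b) = comul (R := k) x := by
  have := sw_lift (TensorProduct.mk k H H) x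
  rwa [TensorProduct.lift_mk] at this

lemma sw_assoc_l {f : H → H → H → M} (F : H →ₗ[k] H →ₗ[k] H →ₗ[k] M)
    (hF : ∀ a b c, f a b c = F a b c) (x : H) :
    sw k x (fun a b => sw k b (fun c d => f a c d)) =
      TensorProduct.lift ((TensorProduct.lift.equiv (.id k) H H M).toLinearMap ∘ₗ F)
        (TensorProduct.map LinearMap.id (comul (R := k)) (comul (R := k) x)) := by
  simp only [hF, sw_lift]
  conv_rhs => rw [← sw_tmul x, map_sw, map_sw]
  rfl

lemma sw_assoc_r {f : H → H → H → M} (F : H →ₗ[k] H →ₗ[k] H →ₗ[k] M)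
    (hF : ∀ a b c, f a b c = F a b c) (x : H) :
    sw k x (fun a b => sw k a (fun c d => f c d b)) =
      TensorProduct.lift ((TensorProduct.lift.equiv (.id k) H H M).toLinearMap ∘ₗ F)
        (TensorProduct.assoc k H H H
          (TensorProduct.map (comul (R := k)) LinearMap.id (comul (R := k) x))) := by
  simp only [hF]
  conv_rhs => rw [← sw_tmul x, map_sw]
  simp only [TensorProduct.map_tmul, ← sw_tmul]
  rw [← LinearEquiv.coe_coe, map_sw, map_sw]
  congr 1; ext a b
  have : (sw k a fun c d => c ⊗ₜ[k] d) ⊗ₜ[k] (LinearMap.id (R := k) b : H) =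
      sw k a (fun c d => (c ⊗ₜ[k] d) ⊗ₜ[k] b) :=
    map_sw ((TensorProduct.mk k (TensorProduct k H H) H).flip b) a _
  rw [this, map_sw, map_sw]
  rfl

lemma sw_assoc {f : H → H → H → M} (hf : Tri k f) (x : H) :
    sw k x (fun a b => sw k b (fun c d => f a c d)) =
      sw k x (fun a b => sw k a (fun c d => f c d b)) := by
  obtain ⟨F, hF⟩ := hf.ex
  rw [sw_assoc_l F hF, sw_assoc_r F hF]
  exact congrArg _ (coassoc_apply x).symm

lemma sw_eq_sum₃ {ι : Type} (s : Finset ι) (u v w : ι → H) (x : H)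
    (h : TensorProduct.map LinearMap.id (comul (R := k)) (comul (R := k) x) =
      ∑ i ∈ s, u i ⊗ₜ[k] (v i ⊗ₜ[k] w i)) {f : H → H → H → M} (hf : Tri k f) :
    sw k x (fun a b => sw k b (fun c d => f a c d)) = ∑ i ∈ s, f (u i) (v i) (w i) := by
  obtain ⟨F, hF⟩ := hf.ex
  rw [sw_assoc_l F hF, h]; simp [hF]

lemma sw_counit_left (f : H → M) (hf : IsLinearMap k f) (x : H) :
    sw k x (fun a b => counit (R := k) a • f b) = f x := by
  have h := congrArg (TensorProduct.lift ((LinearMap.lsmul k M).flip ∘ₗ hf.mk' f).flip)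
    (rTensor_counit_comul (R := k) x)
  rw [← sw_tmul x, map_sw, map_sw] at h
  simpa using h

lemma sw_counit_right (f : H → M) (hf : IsLinearMap k f) (x : H) :
    sw k x (fun a b => counit (R := k) b • f a) = f x := by
  have h := congrArg (TensorProduct.lift ((LinearMap.lsmul k M).flip ∘ₗ hf.mk' f))
    (lTensor_counit_comul (R := k) x)
  rw [← sw_tmul x, map_sw, map_sw] at h
  simpa using h

lemma sw_S_mul (x : H) :
    sw k x (fun a b => antipode k a * b) = counit (R := k) x • (1 : H) := by
  have h := mul_antipode_rTensor_comul_apply (R := k) x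
  rw [← sw_tmul x, map_sw, map_sw] at h
  simpa [Algebra.algebraMap_eq_smul_one] using h

lemma sw_mul_S (x : H) :
    sw k x (fun a b => a * antipode k b) = counit (R := k) x • (1 : H) := by
  have h := mul_antipode_lTensor_comul_apply (R := k) x
  rw [← sw_tmul x, map_sw, map_sw] at h
  simpa [Algebra.algebraMap_eq_smul_one] using h

lemma sw_mul {f : H → H → M} (hf : Bil k f) (x y : H) :
    sw k (x * y) f = sw k x (fun a b => sw k y (fun c d => f (a * c) (b * d))) := by
  obtain ⟨F, hF⟩ := hf.ex
  obtain rfl : f = fun a b => F a b := by ext; exact hF _ _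
  rw [sw_lift, Bialgebra.comul_mul, ← sw_tmul x, ← sw_tmul y]
  have h1 : ∀ (t : TensorProduct k H H) , (sw k x (fun a b => a ⊗ₜ[k] b)) * t =
      sw k x (fun a b => (a ⊗ₜ[k] b) * t) := fun t =>
    map_sw (LinearMap.mulRight k t) x _
  have h2 : ∀ (t : TensorProduct k H H) , t * (sw k y (fun a b => a ⊗ₜ[k] b)) =
      sw k y (fun a b => t * (a ⊗ₜ[k] b)) := fun t =>
    map_sw (LinearMap.mulLeft k t) y _
  simp only [h1, h2, map_sw, Algebra.TensorProduct.tmul_mul_tmul, TensorProduct.lift.tmul]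


lemma smul_tmul_left (r : k) (a b : H) : (r • a) ⊗ₜ[k] b = r • (a ⊗ₜ[k] b) := rfl

attribute [local simp] mul_add add_mul TensorProduct.add_tmul TensorProduct.tmul_add
  smul_tmul_left add_smul smul_add

lemma sw_S {f : H → H → M} (hf : Bil k f) (x : H) :
    sw k (antipode k x) f = sw k x (fun a b => f (antipode k b) (antipode k a)) := by
  set G : H →ₗ[k] TensorProduct k H H := TensorProduct.map (antipode k) (antipode k) ∘ₗ
    (TensorProduct.comm k H H).toLinearMap ∘ₗ comul with hG
  have hGx : ∀ x, G x = sw k x (fun a b => antipode k b ⊗ₜ[k] antipode k a) := by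
    intro x
    rw [hG, LinearMap.comp_apply, LinearMap.comp_apply, ← sw_tmul x, map_sw, map_sw]
    rfl
  have hinv : (WithConv.toConv G * WithConv.toConv (comul (R := k) (A := H))) = 1 := by
    ext x
    rw [LinearMap.convMul_apply, ← sw_tmul x, map_sw, map_sw, LinearMap.convOne_apply]
    simp only [WithConv.ofConv_toConv, TensorProduct.map_tmul, LinearMap.mul'_apply, hGx]
    simp only [← sw_tmul]
    have h1 : ∀ (y : H) (g : H → H → TensorProduct k H H) (t : TensorProduct k H H),
        (sw k y g) * t = sw k y (fun a b => g a b * t) := fun y g t =>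
      map_sw (LinearMap.mulRight k t) y _
    have h2 : ∀ (y : H) (g : H → H → TensorProduct k H H) (t : TensorProduct k H H),
        t * (sw k y g) = sw k y (fun a b => t * g a b) := fun y g t =>
      map_sw (LinearMap.mulLeft k t) y _
    simp only [h1, h2, Algebra.TensorProduct.tmul_mul_tmul]
    rw [← sw_assoc (f := fun a1 a2 b => sw k b (fun b1 b2 =>
      (antipode k a2 * b1) ⊗ₜ[k] (antipode k a1 * b2))) (by constructor <;> intros <;> simp)]
    have h3 : ∀ a b : H, sw k b (fun a2 b' => sw k b' (fun b1 b2 =>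
      (antipode k a2 * b1) ⊗ₜ[k] (antipode k a * b2))) = 1 ⊗ₜ[k] (antipode k a * b) := by
      intro a b
      rw [sw_assoc (f := fun a2 b1 b2 => (antipode k a2 * b1) ⊗ₜ[k] (antipode k a * b2))
        (by constructor <;> intros <;> simp)]
      have h4 : ∀ c d : H, sw k c (fun p q => (antipode k p * q) ⊗ₜ[k] (antipode k a * d)) =
          counit (R := k) c • ((1 : H) ⊗ₜ[k] (antipode k a * d)) := by
        intro c d
        have := map_sw ((TensorProduct.mk k H H).flip (antipode k a * d)) c
          (fun p q => antipode k p * q)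
        rw [sw_S_mul] at this
        simpa using this.symm
      simp only [h4]
      exact sw_counit_left (fun d => (1 : H) ⊗ₜ[k] (antipode k a * d))
        (by constructor <;> intros <;> simp) b
    simp only [h3]
    have := map_sw (TensorProduct.mk k H H 1) x (fun p q => antipode k p * q)
    rw [sw_S_mul] at this
    simp only [TensorProduct.mk_apply] at this
    rw [← this, Algebra.algebraMap_eq_smul_one, Algebra.TensorProduct.one_def,
      TensorProduct.tmul_smul]
  have key := left_inv_eq_right_inv hinv LinearMap.comul_right_inv
  have key2 : G x = comul (R := k) (antipode k x) :=
    congrArg (fun F : WithConv (H →ₗ[k] TensorProduct k H H) => F.ofConv x) key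
  obtain ⟨F, hF⟩ := hf.ex
  obtain rfl : f = fun a b => F a b := by ext; exact hF _ _
  rw [sw_lift, ← key2, hGx, map_sw]
  rfl

lemma sweedlerPow_succ (n : ℕ) (u : H) :
    sweedlerPow k H (n + 1) u = sw k u (fun a b => a * sweedlerPow k H n b) := by
  rw [sweedlerPow, LinearMap.comp_apply, LinearMap.comp_apply, ← sw_tmul u, map_sw, map_sw]
  rfl

lemma sw_SS (x : H) :
    sw k x (fun a b => antipode k (antipode k b) * antipode k a) =
      counit (R := k) x • (1 : H) := by
  have := map_sw (antipode k) x (fun a b => a * antipode k b)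
  rw [sw_mul_S] at this
  simpa [antipode_mul_antidistrib] using this.symm

lemma sw_pow (n : ℕ) : ∀ (x h : H),
    sw k x (fun a b => sw k b (fun c d => antipode k (antipode k c) *
      sweedlerPow k H n (antipode k a * h * antipode k (antipode k d)))) =
    sweedlerPow k H n h * antipode k (antipode k x) := by
  induction n with
  | zero =>
    intro x h
    have h1 : ∀ a b : H, sw k b (fun c d => antipode k (antipode k c) *
      sweedlerPow k H 0 (antipode k a * h * antipode k (antipode k d))) =
        counit (R := k) a • counit (R := k) h • antipode k (antipode k b) := by
      intro a b
      have := sw_counit_right (k := k)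
        (fun c => counit (R := k) a • counit (R := k) h • antipode k (antipode k c))
        (by constructor <;> intros <;> simp [smul_smul, mul_comm, mul_left_comm]) b
      rw [← this]
      congr 1; ext c d
      simp [sweedlerPow, Algebra.algebraMap_eq_smul_one, smul_smul, mul_comm]
    simp only [h1]
    rw [sw_counit_left (k := k) (fun b => counit (R := k) h • antipode k (antipode k b))
      (by constructor <;> intros <;> simp [smul_smul, mul_comm])]
    simp [sweedlerPow, Algebra.algebraMap_eq_smul_one]
  | succ n ih =>
    intro x h
    have e1 : ∀ a d : H, sweedlerPow k H (n + 1) (antipode k a * h * antipode k (antipode k d)) =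
        sw k a fun a1 a2 => sw k h fun h1 h2 => sw k d fun d1 d2 =>
          antipode k a2 * h1 * antipode k (antipode k d1) *
            sweedlerPow k H n (antipode k a1 * h2 * antipode k (antipode k d2)) := by
      intro a d
      rw [sweedlerPow_succ, sw_mul (k := k) (by constructor <;> intros <;> simp),
        sw_mul (k := k) (by constructor <;> intros <;> simp),
        sw_S (k := k) (by constructor <;> intros <;> simp)]
      simp only [mul_assoc]
      congr 1; ext a1 a2; congr 1; ext h1 h2
      rw [sw_S (by constructor <;> intros <;> simp),
        sw_S (by constructor <;> intros <;> simp)]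
    simp only [e1, mul_sw]
    have e2 : ∀ a b : H, (sw k b fun c d => sw k a fun a1 a2 => sw k h fun h1 h2 =>
        sw k d fun d1 d2 => antipode k (antipode k c) *
          (antipode k a2 * h1 * antipode k (antipode k d1) *
            sweedlerPow k H n (antipode k a1 * h2 * antipode k (antipode k d2)))) =
        sw k a fun a1 a2 => sw k b fun c d => sw k h fun h1 h2 =>
        sw k d fun d1 d2 => antipode k (antipode k c) *
          (antipode k a2 * h1 * antipode k (antipode k d1) *
            sweedlerPow k H n (antipode k a1 * h2 * antipode k (antipode k d2))) :=
      fun a b => sw_comm _ _ _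
    simp only [e2]
    rw [← sw_assoc (f := fun a1 a2 b => sw k b fun c d => sw k h fun h1 h2 =>
        sw k d fun d1 d2 => antipode k (antipode k c) *
          (antipode k a2 * h1 * antipode k (antipode k d1) *
            sweedlerPow k H n (antipode k a1 * h2 * antipode k (antipode k d2))))
      (by constructor <;> intros <;> simp)]
    have e3 : ∀ a b : H, (sw k b fun a2 b' => sw k b' fun c d => sw k h fun h1 h2 =>
        sw k d fun d1 d2 => antipode k (antipode k c) *
          (antipode k a2 * h1 * antipode k (antipode k d1) *
            sweedlerPow k H n (antipode k a * h2 * antipode k (antipode k d2)))) =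
        sw k h fun h1 h2 => sw k b fun d1 d2 => h1 * (antipode k (antipode k d1) *
            sweedlerPow k H n (antipode k a * h2 * antipode k (antipode k d2))) := by
      intro a b
      rw [sw_assoc (f := fun a2 c d => sw k h fun h1 h2 =>
        sw k d fun d1 d2 => antipode k (antipode k c) *
          (antipode k a2 * h1 * antipode k (antipode k d1) *
            sweedlerPow k H n (antipode k a * h2 * antipode k (antipode k d2))))
        (by constructor <;> intros <;> simp)]
      rw [← sw_counit_left (k := k) (fun b => sw k h fun h1 h2 => sw k b fun d1 d2 =>
        h1 * (antipode k (antipode k d1) *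
            sweedlerPow k H n (antipode k a * h2 * antipode k (antipode k d2))))
        (by constructor <;> intros <;> simp)]
      congr 1; ext c d
      have e4 : ∀ z : H, counit (R := k) c • z =
          sw k c fun p q => antipode k (antipode k q) * antipode k p * z := by
        intro z
        rw [← sw_mul', sw_SS]; simp
      rw [e4]
      congr 1; ext p q
      simp only [mul_sw, mul_assoc]
    simp only [e3]
    rw [sw_comm]
    simp only [← mul_sw, ih]
    rw [sweedlerPow_succ, sw_mul']
    simp only [mul_assoc]


lemma intA {Λ : H} (hΛ : ∀ h : H, h * Λ = counit (R := k) h • Λ) {f : H → H → M}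
    (hf : Bil k f) (h : H) :
    sw k Λ (fun l m => f (antipode k h * l) m) = sw k Λ (fun l m => f l (h * m)) := by
  obtain ⟨F, hF⟩ := hf.ex
  obtain rfl : f = fun a b => F a b := by ext; exact hF _ _
  rw [← sw_counit_right (k := k) (fun h => sw k Λ (fun l m => F (antipode k h * l) m))
    (by constructor <;> intros <;> simp)]
  rw [← sw_counit_left (k := k) (fun h => sw k Λ (fun l m => F l (h * m)))
    (by constructor <;> intros <;> simp)]
  have e1 : ∀ p v : H, counit (R := k) v • sw k Λ (fun l m => F (antipode k p * l) m) =
      sw k v fun q r => sw k Λ fun l m => F (antipode k p * (q * l)) (r * m) := by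
    intro p v
    rw [← sw_smul, ← hΛ, sw_mul (k := k) (by constructor <;> intros <;> simp)]
  have e2 : ∀ u v : H, counit (R := k) u • sw k Λ (fun l m => F l (v * m)) =
      sw k u fun p q => sw k Λ fun l m => F (antipode k p * (q * l)) (v * m) := by
    intro u v
    rw [sw_comm, ← sw_smul_fun]
    congr 1; ext l m
    have := map_sw (F.flip (v * m)) u (fun p q => antipode k p * q * l)
    rw [← sw_mul', sw_S_mul] at this
    simpa [mul_assoc] using this
  simp only [e1, e2]
  rw [sw_assoc (f := fun p q r => sw k Λ fun l m => F (antipode k p * (q * l)) (r * m))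
    (by constructor <;> intros <;> simp)]

lemma intC {Λ : H} {α : H → k} (hα : ∀ h : H, Λ * h = α h • Λ) {f : H → H → M}
    (hf : Bil k f) (h : H) :
    sw k Λ (fun l m => f (l * h) m) =
      sw k h (fun p q => α p • sw k Λ (fun l m => f l (m * antipode k q))) := by
  obtain ⟨F, hF⟩ := hf.ex
  obtain rfl : f = fun a b => F a b := by ext; exact hF _ _
  rw [← sw_counit_right (k := k) (fun h => sw k Λ (fun l m => F (l * h) m))
    (by constructor <;> intros <;> simp)]
  have e1 : ∀ p q : H, α p • sw k Λ (fun l m => F l (m * antipode k q)) =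
      sw k p fun r s => sw k Λ fun l m => F (l * r) (m * (s * antipode k q)) := by
    intro p q
    rw [← sw_smul, ← hα, sw_mul (k := k) (by constructor <;> intros <;> simp), sw_comm]
    simp only [mul_assoc]
  have e2 : ∀ u v : H, counit (R := k) v • sw k Λ (fun l m => F (l * u) m) =
      sw k v fun r s => sw k Λ fun l m => F (l * u) (m * (r * antipode k s)) := by
    intro u v
    rw [sw_comm, ← sw_smul_fun]
    congr 1; ext l m
    have := map_sw (F (l * u)) v (fun p q => m * (p * antipode k q))
    rw [← mul_sw, sw_mul_S] at this
    simpa using this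
  simp only [e1, e2]
  rw [sw_assoc (f := fun u r s => sw k Λ fun l m => F (l * u) (m * (r * antipode k s)))
    (by constructor <;> intros <;> simp)]

lemma int_one {Λ : H} {lam : H →ₗ[k] k}
    (hlam : ∀ h : H, (TensorProduct.lid k H) ((TensorProduct.map lam LinearMap.id)
        (comul (R := k) h)) = lam h • (1 : H)) (hnorm : lam Λ = 1) :
    sw k Λ (fun l m => lam l • m) = 1 := by
  have h := hlam Λ
  rw [hnorm, one_smul, ← sw_tmul Λ, map_sw, ← LinearEquiv.coe_coe, map_sw] at h
  simpa using h

lemma int_E1 {Λ : H} {lam : H →ₗ[k] k} (hΛ : ∀ h : H, h * Λ = counit (R := k) h • Λ)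
    (h1 : sw k Λ (fun l m => lam l • m) = 1) (h : H) :
    sw k Λ (fun l m => lam (antipode k h * l) • m) = h := by
  rw [intA (k := k) hΛ (f := fun l m => lam l • m)
    (by constructor <;> intros <;> simp [smul_smul, mul_comm])]
  have := mul_sw (k := k) h Λ (fun l m => lam l • m)
  rw [h1] at this
  simpa using this.symm

lemma int_E2 {Λ : H} {lam : H →ₗ[k] k} (hΛ : ∀ h : H, h * Λ = counit (R := k) h • Λ)
    (h1 : sw k Λ (fun l m => lam l • m) = 1) (h : H) :
    sw k Λ (fun l m => lam (h * l) • antipode k m) = h := by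
  have inj : Function.Injective (antipode k (A := H)) := by
    intro a b hab
    rw [← int_E1 hΛ h1 a, ← int_E1 hΛ h1 b, hab]
  obtain ⟨g, rfl⟩ := LinearMap.injective_iff_surjective.mp inj h
  have := map_sw (antipode k) Λ (fun l m => lam (antipode k g * l) • m)
  rw [int_E1 hΛ h1] at this
  simpa using this.symm

lemma int_E3 {Λ : H} {lam : H →ₗ[k] k} (hΛ : ∀ h : H, h * Λ = counit (R := k) h • Λ)
    (h1 : sw k Λ (fun l m => lam l • m) = 1) (h : H) :
    sw k Λ (fun l m => lam (antipode k m * h) • l) = h := by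
  let u : H →ₗ[k] Module.Dual k H := LinearMap.mk₂ k (fun a b => lam (a * b))
    (by simp) (by simp) (by simp) (by simp)
  have hu : ∀ a b, u a b = lam (a * b) := fun _ _ => rfl
  have inj : Function.Injective u := by
    intro a b hab
    rw [← int_E2 hΛ h1 a, ← int_E2 hΛ h1 b]
    simp only [← hu, hab]
  have surj : Function.Surjective u :=
    (LinearMap.injective_iff_surjective_of_finrank_eq_finrank
      (Subspace.dual_finrank_eq).symm).mp inj
  rw [← sub_eq_zero, ← Module.forall_dual_apply_eq_zero_iff k]
  intro φ
  rw [map_sub, sub_eq_zero]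
  obtain ⟨g, rfl⟩ := surj φ
  rw [map_sw]
  have := congrArg (fun z => lam (z * h)) (int_E2 hΛ h1 g)
  simp only [sw_mul', map_sw] at this
  rw [hu, ← this]
  congr 1; ext l m
  simp [hu, mul_comm]

lemma int_alpha {Λ : H} {lam : H →ₗ[k] k} (hΛ : ∀ h : H, h * Λ = counit (R := k) h • Λ)
    (h1 : sw k Λ (fun l m => lam l • m) = 1) (h : H) :
    Λ * h = lam (Λ * h) • Λ := by
  conv_lhs => rw [← int_E3 hΛ h1 (Λ * h)]
  have := sw_counit_right (k := k) (fun l => lam (Λ * h) • l)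
    (by constructor <;> intros <;> simp [smul_smul, mul_comm]) Λ
  rw [← this]
  congr 1; ext l m
  rw [← mul_assoc, hΛ]
  simp [smul_smul]

lemma nakayama {Λ : H} {lam : H →ₗ[k] k} (hΛ : ∀ h : H, h * Λ = counit (R := k) h • Λ)
    (h1 : sw k Λ (fun l m => lam l • m) = 1) (w y : H) :
    lam (w * y) = sw k y (fun p q => lam (Λ * p) • lam (antipode k (antipode k q) * w)) := by
  conv_lhs => rw [← int_E3 hΛ h1 w]
  rw [sw_mul', map_sw]
  have := intC (k := k) (int_alpha hΛ h1) (f := fun l m => lam (antipode k m * w) • lam l)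
    (by constructor <;> intros <;> simp <;> ring) y
  simp only [smul_mul_assoc, map_smul]
  rw [this]
  congr 1; ext p q; congr 1
  have e := congrArg (fun z => lam (antipode k (antipode k q) * antipode k z * w)) h1
  simp only [map_sw, mul_sw, sw_mul', antipode_one, mul_one] at e
  rw [← e]
  congr 1; ext l m
  simp [antipode_mul_antidistrib, mul_assoc, mul_comm]

lemma nakayama' {Λ : H} {lam : H →ₗ[k] k} (hΛ : ∀ h : H, h * Λ = counit (R := k) h • Λ)
    (h1 : sw k Λ (fun l m => lam l • m) = 1) (x z : H) :
    lam (antipode k (x * z)) = sw k x (fun u v => lam (Λ * antipode k v) •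
      lam (antipode k (z * antipode k (antipode k u)))) := by
  rw [antipode_mul_antidistrib, nakayama hΛ h1, sw_S (k := k)
    (by constructor <;> intros <;> simp <;> ring)]
  simp only [antipode_mul_antidistrib]

lemma main_sw {Λ : H} {lam : H →ₗ[k] k} (hΛ : ∀ h : H, h * Λ = counit (R := k) h • Λ)
    (h1 : sw k Λ (fun l m => lam l • m) = 1) (x : H) (n : ℕ) (Y : H →ₗ[k] H) :
    lam (antipode k (x * sw k Λ (fun l m => Y l * sweedlerPow k H n m))) =
    lam (antipode k (sw k x fun a b => sw k b fun c d => sw k Λ fun l m =>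
      Y (antipode k (antipode k a) * l * antipode k d) * antipode k (antipode k c) *
        sweedlerPow k H n m)) := by
  have e1 : ∀ a c d : H, (sw k Λ fun l m =>
      Y (antipode k (antipode k a) * l * antipode k d) * antipode k (antipode k c) *
        sweedlerPow k H n m) =
      sw k d fun p q => lam (Λ * antipode k q) • sw k Λ fun l m => Y l *
        (antipode k (antipode k c) *
          sweedlerPow k H n (antipode k a * m * antipode k (antipode k p))) := by
    intro a c d
    rw [intA (k := k) hΛ (f := fun l m => Y (l * antipode k d) * antipode k (antipode k c) *
        sweedlerPow k H n m) (by constructor <;> intros <;> simp)]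
    rw [intC (k := k) (int_alpha hΛ h1) (f := fun l m => Y l * antipode k (antipode k c) *
        sweedlerPow k H n (antipode k a * m)) (by constructor <;> intros <;> simp)]
    rw [sw_S (k := k) (by constructor <;> intros <;> simp [smul_smul, mul_comm])]
    simp only [mul_assoc]
  simp only [e1]
  have e2 : ∀ a b : H, (sw k b fun c d => sw k d fun p q => lam (Λ * antipode k q) •
      sw k Λ fun l m => Y l * (antipode k (antipode k c) *
          sweedlerPow k H n (antipode k a * m * antipode k (antipode k p)))) =
      sw k b fun d q => sw k d fun c p => lam (Λ * antipode k q) •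
      sw k Λ fun l m => Y l * (antipode k (antipode k c) *
          sweedlerPow k H n (antipode k a * m * antipode k (antipode k p))) := by
    intro a b
    rw [sw_assoc (f := fun c p q => lam (Λ * antipode k q) •
      sw k Λ fun l m => Y l * (antipode k (antipode k c) *
          sweedlerPow k H n (antipode k a * m * antipode k (antipode k p))))
      (by constructor <;> intros <;> simp [smul_smul, mul_comm])]
  simp only [e2]
  rw [sw_assoc (f := fun a d q => sw k d fun c p => lam (Λ * antipode k q) •
      sw k Λ fun l m => Y l * (antipode k (antipode k c) *
          sweedlerPow k H n (antipode k a * m * antipode k (antipode k p))))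
      (by constructor <;> intros <;> simp [smul_smul, mul_comm])]
  have e3 : ∀ u q : H, (sw k u fun a d => sw k d fun c p => lam (Λ * antipode k q) •
      sw k Λ fun l m => Y l * (antipode k (antipode k c) *
          sweedlerPow k H n (antipode k a * m * antipode k (antipode k p)))) =
      lam (Λ * antipode k q) • (sw k Λ (fun l m => Y l * sweedlerPow k H n m) *
        antipode k (antipode k u)) := by
    intro u q
    simp only [sw_smul_fun, sw_mul', mul_assoc]
    congr 1
    simp only [← sw_pow n u, mul_sw]
    rw [sw_comm]
    congr 1; ext a d
    rw [sw_comm]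
    simp only [mul_assoc]
  simp only [e3]
  rw [nakayama' hΛ h1, map_sw, map_sw]
  simp only [map_smul]

end Aux

theorem statement3
    (k H : Type) [Field k] [Ring H] [HopfAlgebra k H] [FiniteDimensional k H]
    (S : H →ₗ[k] H) (hS : S = HopfAlgebra.antipode (R := k))
    (lam : H →ₗ[k] k) (Λ : H)
    (hΛ : ∀ h : H, h * Λ = Coalgebra.counit (R := k) h • Λ)
    (hlam : ∀ h : H,
      (TensorProduct.lid k H) ((TensorProduct.map lam LinearMap.id)
        (Coalgebra.comul (R := k) h)) = lam h • (1 : H))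
    (hnorm : lam Λ = 1)
    (n : ℕ) (hn : 1 ≤ n) (x : H) (Y : H →ₗ[k] H)
    -- a finite-sum Sweedler representation Δ(Λ) = Σᵢ a i ⊗ b i :
    (m₁ : ℕ) (a b : Fin m₁ → H)
    (hrep₁ : Coalgebra.comul (R := k) Λ = ∑ i, a i ⊗ₜ[k] b i)
    -- a finite-sum Sweedler representation Δ³(x) = Σⱼ x1 j ⊗ x2 j ⊗ x3 j :
    (m₂ : ℕ) (x1 x2 x3 : Fin m₂ → H)
    (hrep₂ : (TensorProduct.map LinearMap.id (Coalgebra.comul (R := k)))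
        (Coalgebra.comul (R := k) x) = ∑ j, x1 j ⊗ₜ[k] (x2 j ⊗ₜ[k] x3 j)) :
    lam (S (x * ∑ i, Y (a i) * sweedlerPow k H n (b i))) =
      lam (S (∑ j, ∑ i,
        Y (S (S (x1 j)) * a i * S (x3 j)) * S (S (x2 j)) * sweedlerPow k H n (b i))) := by
  subst hS
  have h1 := int_one hlam hnorm
  have key := main_sw hΛ h1 x n Y
  rw [sw_eq_sum Finset.univ a b Λ hrep₁
    (by constructor <;> intros <;> simp [mul_add, add_mul])] at key
  rw [key, sw_eq_sum₃ Finset.univ x1 x2 x3 x hrep₂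
    (by constructor <;> intros <;> simp [mul_add, add_mul])]
  congr 2
  refine Finset.sum_congr rfl fun j _ => ?_
  rw [sw_eq_sum Finset.univ a b Λ hrep₁
    (by constructor <;> intros <;> simp [mul_add, add_mul])]
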